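/- Under the adapted cuspidal-edge setting, with the extended principal vector field Ṽ = Ṽ₁∂_u + Ṽ₂∂_v given by Ṽ₁ = v(λM̃ − κ̂F̃) and Ṽ₂ = −λL̃ + κ̂Ẽ: the Gaussian curvature K_{ŴFC} of the focal surface ŴFC_f vanishes at a point p = (u₀,0) of the u-axis if and only if p is a sub-parabolic point of f, i.e. the directional derivative Ṽκ(p) = Ṽ₁(p)κ_u(p) + Ṽ₂(p)κ_v(p) of the bounded principal curvature κ vanishes at p. -/

import Mathlib

noncomputable section

local notation "⟪" x ", " y "⟫" => @inner ℝ _ _ x y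

/-- Euclidean 3-space. -/
abbrev E3 : Type := EuclideanSpace ℝ (Fin 3)

/-- The vector in `E3` with coordinates `(a, b, c)`. -/
def e3 (a b c : ℝ) : E3 := (WithLp.equiv 2 (Fin 3 → ℝ)).symm ![a, b, c]

/-- Cross product on `E3`. -/
def cross3 (a b : E3) : E3 :=
  e3 (a 1 * b 2 - a 2 * b 1) (a 2 * b 0 - a 0 * b 2) (a 0 * b 1 - a 1 * b 0)

/-- Scalar triple product `det(a,b,c)`. -/
def det3 (a b c : E3) : ℝ := ⟪a, cross3 b c⟫

/-- Partial derivative in the `u`-direction. -/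
def pu {E : Type*} [NormedAddCommGroup E] [NormedSpace ℝ E] (g : ℝ × ℝ → E) (p : ℝ × ℝ) : E :=
  fderiv ℝ g p (1, 0)

/-- Partial derivative in the `v`-direction. -/
def pv {E : Type*} [NormedAddCommGroup E] [NormedSpace ℝ E] (g : ℝ × ℝ → E) (p : ℝ × ℝ) : E :=
  fderiv ℝ g p (0, 1)

/-- Signed area density `λ = det(f_u, f_v, ν)`. -/
def lam (f ν : ℝ × ℝ → E3) (p : ℝ × ℝ) : ℝ := det3 (pu f p) (pv f p) (ν p)


/-- `Ẽ = |f_u|²`. -/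
def Etil (f : ℝ × ℝ → E3) (p : ℝ × ℝ) : ℝ := ‖pu f p‖ ^ 2

/-- `F̃ = ⟨f_u, h⟩`. -/
def Ftil (f h : ℝ × ℝ → E3) (p : ℝ × ℝ) : ℝ := ⟪pu f p, h p⟫

/-- `G̃ = |h|²`. -/
def Gtil (h : ℝ × ℝ → E3) (p : ℝ × ℝ) : ℝ := ‖h p‖ ^ 2

/-- `L̃ = −⟨f_u, ν_u⟩`. -/
def Ltil (f ν : ℝ × ℝ → E3) (p : ℝ × ℝ) : ℝ := -⟪pu f p, pu ν p⟫

/-- `M̃ = −⟨h, ν_u⟩`. -/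
def Mtil (ν h : ℝ × ℝ → E3) (p : ℝ × ℝ) : ℝ := -⟪h p, pu ν p⟫

/-- `Ñ = −⟨h, ν_v⟩`. -/
def Ntil (ν h : ℝ × ℝ → E3) (p : ℝ × ℝ) : ℝ := -⟪h p, pv ν p⟫

/-- `Ã = ẼÑ − 2vF̃M̃ + vG̃L̃`. -/
def Atil (f ν h : ℝ × ℝ → E3) (p : ℝ × ℝ) : ℝ :=
  Etil f p * Ntil ν h p - 2 * p.2 * Ftil f h p * Mtil ν h p + p.2 * Gtil h p * Ltil f ν p

/-- `B̃ = √(Ã² − 4v(ẼG̃−F̃²)(L̃Ñ−vM̃²))`. -/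
def Btil (f ν h : ℝ × ℝ → E3) (p : ℝ × ℝ) : ℝ :=
  Real.sqrt ((Atil f ν h p) ^ 2 -
    4 * p.2 * (Etil f p * Gtil h p - (Ftil f h p) ^ 2) *
      (Ltil f ν p * Ntil ν h p - p.2 * (Mtil ν h p) ^ 2))

/-- The bounded principal curvature `κ = 2(L̃Ñ−vM̃²)/(Ã+B̃)`. -/
def kap (f ν h : ℝ × ℝ → E3) (p : ℝ × ℝ) : ℝ :=
  2 * (Ltil f ν p * Ntil ν h p - p.2 * (Mtil ν h p) ^ 2) / (Atil f ν h p + Btil f ν h p)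

/-- `κ̂ = (Ã+B̃)/(2|f_u×h|)`, the smooth extension of `λ·κ₁`. -/
def kaphat (f ν h : ℝ × ℝ → E3) (p : ℝ × ℝ) : ℝ :=
  (Atil f ν h p + Btil f ν h p) / (2 * ‖cross3 (pu f p) (h p)‖)

/-- Singular curvature `κ_s` along the u-axis. -/
def kappas (f ν : ℝ × ℝ → E3) (u : ℝ) : ℝ :=
  det3 (pu f (u, 0)) (pu (pu f) (u, 0)) (ν (u, 0)) / ‖pu f (u, 0)‖ ^ 3

/-- Cuspidal curvature `κ_c` along the u-axis. -/
def kappac (f ν h : ℝ × ℝ → E3) (u : ℝ) : ℝ :=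
  2 * Etil f (u, 0) ^ ((3 : ℝ) / 4) * Ntil ν h (u, 0) /
    (Etil f (u, 0) * Gtil h (u, 0) - (Ftil f h (u, 0)) ^ 2) ^ ((3 : ℝ) / 4)

/-- Cusp-directional torsion `κ_t` along the u-axis. -/
def kappat (f ν h : ℝ × ℝ → E3) (u : ℝ) : ℝ :=
  (Etil f (u, 0) * Mtil ν h (u, 0) - Ftil f h (u, 0) * Ltil f ν (u, 0)) /
    (Etil f (u, 0) * Real.sqrt (Etil f (u, 0) * Gtil h (u, 0) - (Ftil f h (u, 0)) ^ 2))

/-- The focal surface `ŴFC_f = f + (λ/κ̂)ν`. -/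
def FChat (f ν h : ℝ × ℝ → E3) (p : ℝ × ℝ) : E3 :=
  f p + (lam f ν p / kaphat f ν h p) • ν p

/-- Coefficient `E` of the first fundamental form of a surface `W`. -/
def surfE (W : ℝ × ℝ → E3) (p : ℝ × ℝ) : ℝ := ‖pu W p‖ ^ 2

/-- Coefficient `F` of the first fundamental form of a surface `W`. -/
def surfF (W : ℝ × ℝ → E3) (p : ℝ × ℝ) : ℝ := ⟪pu W p, pv W p⟫

/-- Coefficient `G` of the first fundamental form of a surface `W`. -/
def surfG (W : ℝ × ℝ → E3) (p : ℝ × ℝ) : ℝ := ‖pv W p‖ ^ 2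

/-- Unit normal `n = (W_u × W_v)/|W_u × W_v|` of a surface `W`. -/
def surfn (W : ℝ × ℝ → E3) (p : ℝ × ℝ) : E3 :=
  ‖cross3 (pu W p) (pv W p)‖⁻¹ • cross3 (pu W p) (pv W p)

/-- Coefficient `L = ⟨W_uu, n⟩` of the second fundamental form. -/
def surfL (W : ℝ × ℝ → E3) (p : ℝ × ℝ) : ℝ := ⟪pu (pu W) p, surfn W p⟫

/-- Coefficient `M = ⟨W_uv, n⟩` of the second fundamental form. -/
def surfM (W : ℝ × ℝ → E3) (p : ℝ × ℝ) : ℝ := ⟪pv (pu W) p, surfn W p⟫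

/-- Coefficient `N = ⟨W_vv, n⟩` of the second fundamental form. -/
def surfN (W : ℝ × ℝ → E3) (p : ℝ × ℝ) : ℝ := ⟪pv (pv W) p, surfn W p⟫

/-- Gaussian curvature of a surface `W`. -/
def gaussK (W : ℝ × ℝ → E3) (p : ℝ × ℝ) : ℝ :=
  (surfL W p * surfN W p - (surfM W p) ^ 2) /
    (surfE W p * surfG W p - (surfF W p) ^ 2)

/-- Mean curvature of a surface `W` (w.r.t. the unit normal `surfn W`). -/
def meanH (W : ℝ × ℝ → E3) (p : ℝ × ℝ) : ℝ :=
  (surfE W p * surfN W p - 2 * surfF W p * surfM W p + surfG W p * surfL W p) /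
    (2 * (surfE W p * surfG W p - (surfF W p) ^ 2))



open Filter Topology

theorem inner_E3 (x y : E3) : ⟪x, y⟫ = x 0 * y 0 + x 1 * y 1 + x 2 * y 2 := by
  simp [PiLp.inner_apply, Fin.sum_univ_three, mul_comm]

@[simp] theorem cross3_zero (a b : E3) : cross3 a b 0 = a 1 * b 2 - a 2 * b 1 := rfl

@[simp] theorem cross3_one (a b : E3) : cross3 a b 1 = a 2 * b 0 - a 0 * b 2 := rfl

@[simp] theorem cross3_two (a b : E3) : cross3 a b 2 = a 0 * b 1 - a 1 * b 0 := rfl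

theorem cross3_smul (a b : E3) (r : ℝ) : cross3 a (r • b) = r • cross3 a b := by
  ext i
  fin_cases i <;> simp <;> ring

theorem norm_cross3_sq (a b : E3) :
    ‖cross3 a b‖ ^ 2 = ‖a‖ ^ 2 * ‖b‖ ^ 2 - (⟪a, b⟫ : ℝ) ^ 2 := by
  simp only [← real_inner_self_eq_norm_sq, inner_E3, cross3_zero, cross3_one, cross3_two]
  ring

theorem inner_cross3_cyclic (a b c : E3) : (⟪a, cross3 b c⟫ : ℝ) = ⟪c, cross3 a b⟫ := by
  simp only [inner_E3, cross3_zero, cross3_one, cross3_two]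
  ring

theorem inner_cross3_swap (a b c : E3) : (⟪b, cross3 a c⟫ : ℝ) = -⟪c, cross3 a b⟫ := by
  simp only [inner_E3, cross3_zero, cross3_one, cross3_two]
  ring

theorem inner_cross3_cross3 (a b x : E3) :
    (⟪x, cross3 a (cross3 a b)⟫ : ℝ) = ⟪a, b⟫ * ⟪a, x⟫ - ‖a‖ ^ 2 * ⟪b, x⟫ := by
  simp only [← real_inner_self_eq_norm_sq, inner_E3, cross3_zero, cross3_one, cross3_two]
  ring

/-- A vector orthogonal to `a` and `n` is a multiple of `a × n`. -/
theorem inner_mul_norm_cross3_sq {a n x : E3} (ha : (⟪a, x⟫ : ℝ) = 0) (hn : (⟪n, x⟫ : ℝ) = 0)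
    (y : E3) :
    (⟪y, x⟫ : ℝ) * ‖cross3 a n‖ ^ 2 = ⟪x, cross3 a n⟫ * ⟪y, cross3 a n⟫ := by
  have key : (⟪y, x⟫ : ℝ) * ‖cross3 a n‖ ^ 2 = ⟪x, cross3 a n⟫ * ⟪y, cross3 a n⟫
      - ⟪y, cross3 (cross3 a n) n⟫ * ⟪a, x⟫ + ⟪y, cross3 (cross3 a n) a⟫ * ⟪n, x⟫ := by
    simp only [← real_inner_self_eq_norm_sq, inner_E3, cross3_zero, cross3_one, cross3_two]
    ring
  rw [key, ha, hn]
  ring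

section Partial

variable {E : Type*} [NormedAddCommGroup E] [NormedSpace ℝ E] {g k : ℝ × ℝ → E} {p : ℝ × ℝ}

theorem ContDiffAt.partial_u (hg : ContDiffAt ℝ (⊤ : ℕ∞) g p) : ContDiffAt ℝ (⊤ : ℕ∞) (pu g) p :=
  (hg.fderiv_right (m := (⊤ : ℕ∞)) (by simp)).clm_apply contDiffAt_const

theorem ContDiffAt.partial_v (hg : ContDiffAt ℝ (⊤ : ℕ∞) g p) : ContDiffAt ℝ (⊤ : ℕ∞) (pv g) p :=
  (hg.fderiv_right (m := (⊤ : ℕ∞)) (by simp)).clm_apply contDiffAt_const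

theorem ContDiffAt.differentiableAt_top (hg : ContDiffAt ℝ (⊤ : ℕ∞) g p) :
    DifferentiableAt ℝ g p :=
  hg.differentiableAt (by simp)

theorem ContDiffAt.eventually_differentiableAt (hg : ContDiffAt ℝ (⊤ : ℕ∞) g p) :
    ∀ᶠ q in 𝓝 p, DifferentiableAt ℝ g q :=
  ((hg.of_le (m := 1) (by simp)).eventually (by simp)).mono
    fun q hq => hq.differentiableAt (by simp)

theorem pu_congr (hgk : g =ᶠ[𝓝 p] k) : pu g =ᶠ[𝓝 p] pu k :=
  hgk.fderiv.fun_comp (fun T => T (1, 0))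

theorem pv_congr (hgk : g =ᶠ[𝓝 p] k) : pv g =ᶠ[𝓝 p] pv k :=
  hgk.fderiv.fun_comp (fun T => T (0, 1))

@[simp] theorem pv_const (x : E) : pv (fun _ : ℝ × ℝ => x) p = 0 := by
  simp [pv]

theorem pu_add (hg : DifferentiableAt ℝ g p) (hk : DifferentiableAt ℝ k p) :
    pu (fun q => g q + k q) p = pu g p + pu k p := by
  simp [pu, fderiv_fun_add hg hk]

theorem pv_add (hg : DifferentiableAt ℝ g p) (hk : DifferentiableAt ℝ k p) :
    pv (fun q => g q + k q) p = pv g p + pv k p := by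
  simp [pv, fderiv_fun_add hg hk]

theorem pv_sub (hg : DifferentiableAt ℝ g p) (hk : DifferentiableAt ℝ k p) :
    pv (fun q => g q - k q) p = pv g p - pv k p := by
  simp [pv, fderiv_fun_sub hg hk]

theorem pu_smul {c : ℝ × ℝ → ℝ} (hc : DifferentiableAt ℝ c p) (hg : DifferentiableAt ℝ g p) :
    pu (fun q => c q • g q) p = c p • pu g p + pu c p • g p := by
  simp [pu, fderiv_fun_smul hc hg]

theorem pv_smul {c : ℝ × ℝ → ℝ} (hc : DifferentiableAt ℝ c p) (hg : DifferentiableAt ℝ g p) :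
    pv (fun q => c q • g q) p = c p • pv g p + pv c p • g p := by
  simp [pv, fderiv_fun_smul hc hg]

theorem pv_mul {c d : ℝ × ℝ → ℝ} (hc : DifferentiableAt ℝ c p) (hd : DifferentiableAt ℝ d p) :
    pv (fun q => c q * d q) p = c p * pv d p + d p * pv c p := by
  simp [pv, fderiv_fun_mul hc hd]

@[simp] theorem pu_snd : pu (fun q : ℝ × ℝ => q.2) p = 0 := by
  change fderiv ℝ Prod.snd p (1, 0) = 0
  simp [fderiv_snd]

@[simp] theorem pv_snd : pv (fun q : ℝ × ℝ => q.2) p = 1 := by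
  change fderiv ℝ Prod.snd p (0, 1) = 1
  simp [fderiv_snd]

theorem pu_add_snd_smul (hg : DifferentiableAt ℝ g p) (hk : DifferentiableAt ℝ k p) :
    pu (fun q => g q + q.2 • k q) p = pu g p + p.2 • pu k p := by
  rw [pu_add hg (differentiableAt_snd.fun_smul hk), pu_smul differentiableAt_snd hk]
  simp

theorem pv_add_snd_smul (hg : DifferentiableAt ℝ g p) (hk : DifferentiableAt ℝ k p) :
    pv (fun q => g q + q.2 • k q) p = pv g p + p.2 • pv k p + k p := by
  rw [pv_add hg (differentiableAt_snd.fun_smul hk), pv_smul differentiableAt_snd hk]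
  simp [add_assoc]

theorem pu_snd_smul (hk : DifferentiableAt ℝ k p) :
    pu (fun q => q.2 • k q) p = p.2 • pu k p := by
  simp [pu_smul differentiableAt_snd hk]

theorem pu_inner {a b : ℝ × ℝ → E3} (ha : DifferentiableAt ℝ a p) (hb : DifferentiableAt ℝ b p) :
    pu (fun q => (⟪a q, b q⟫ : ℝ)) p = ⟪a p, pu b p⟫ + ⟪pu a p, b p⟫ := by
  simp [pu, fderiv_inner_apply ℝ ha hb]

theorem pv_inner {a b : ℝ × ℝ → E3} (ha : DifferentiableAt ℝ a p) (hb : DifferentiableAt ℝ b p) :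
    pv (fun q => (⟪a q, b q⟫ : ℝ)) p = ⟪a p, pv b p⟫ + ⟪pv a p, b p⟫ := by
  simp [pv, fderiv_inner_apply ℝ ha hb]

theorem pv_pu_comm (hg : ContDiffAt ℝ (⊤ : ℕ∞) g p) : pv (pu g) p = pu (pv g) p := by
  have hd : DifferentiableAt ℝ (fderiv ℝ g) p :=
    (hg.fderiv_right (m := (⊤ : ℕ∞)) (by simp)).differentiableAt_top
  have hs := hg.isSymmSndFDerivAt (by simpa using WithTop.coe_le_coe.2 (le_top : (2 : ℕ∞) ≤ ⊤))
  have h1 : ∀ e e' : ℝ × ℝ,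
      fderiv ℝ (fun q => fderiv ℝ g q e) p e' = fderiv ℝ (fderiv ℝ g) p e' e := by
    intro e e'
    simp [fderiv_clm_apply hd (differentiableAt_const e)]
  exact (h1 _ _).trans ((hs _ _).trans (h1 _ _).symm)

end Partial

theorem gaussK_congr {W W' : ℝ × ℝ → E3} {p : ℝ × ℝ} (hW : W =ᶠ[𝓝 p] W') :
    gaussK W p = gaussK W' p := by
  have hu := pu_congr hW
  have hv := pv_congr hW
  simp only [gaussK, surfL, surfM, surfN, surfE, surfF, surfG, surfn, hu.eq_of_nhds, hv.eq_of_nhds,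
    (pu_congr hu).eq_of_nhds, (pv_congr hu).eq_of_nhds, (pv_congr hv).eq_of_nhds]

theorem pv_pu_eq_zero {f h : ℝ × ℝ → E3} {p : ℝ × ℝ} (hp : p.2 = 0)
    (hf : ContDiffAt ℝ (⊤ : ℕ∞) f p) (hh : ContDiffAt ℝ (⊤ : ℕ∞) h p)
    (hfv : pv f =ᶠ[𝓝 p] fun q => q.2 • h q) : pv (pu f) p = 0 := by
  rw [pv_pu_comm hf, (pu_congr hfv).eq_of_nhds, pu_snd_smul hh.differentiableAt_top, hp, zero_smul]

/-- The Gaussian curvature of `f + v r ν` at a point of the singular curve of `f`. -/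
theorem gaussK_offset_eq_zero_iff {f ν h : ℝ × ℝ → E3} {r : ℝ × ℝ → ℝ} {p : ℝ × ℝ}
    (hp : p.2 = 0) (hf : ContDiffAt ℝ (⊤ : ℕ∞) f p) (hν : ContDiffAt ℝ (⊤ : ℕ∞) ν p)
    (hh : ContDiffAt ℝ (⊤ : ℕ∞) h p) (hr : ContDiffAt ℝ (⊤ : ℕ∞) r p)
    (hfv : pv f =ᶠ[𝓝 p] fun q => q.2 • h q) (hν1 : ‖ν p‖ = 1) (ho : (⟪pu f p, ν p⟫ : ℝ) = 0)
    (hfu : pu f p ≠ 0) (hr0 : r p ≠ 0) :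
    gaussK (fun q => f q + q.2 • r q • ν q) p = 0 ↔
      (⟪pu (pu f) p, cross3 (pu f p) (ν p)⟫ : ℝ) *
          (⟪h p, cross3 (pu f p) (ν p)⟫ + 2 * r p * ⟪pv ν p, cross3 (pu f p) (ν p)⟫) =
        (r p * ⟪pu ν p, cross3 (pu f p) (ν p)⟫) ^ 2 := by
  set W : ℝ × ℝ → E3 := fun q => f q + q.2 • r q • ν q
  set R : ℝ × ℝ → E3 := fun q => r q • ν q with hRdef
  have hR : ContDiffAt ℝ (⊤ : ℕ∞) R p := hr.smul hν
  have hWu : pu W =ᶠ[𝓝 p] fun q => pu f q + q.2 • pu R q := by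
    filter_upwards [hf.eventually_differentiableAt, hR.eventually_differentiableAt] with q h1 h2
    exact pu_add_snd_smul h1 h2
  have hWv : pv W =ᶠ[𝓝 p] fun q => R q + q.2 • (h q + pv R q) := by
    filter_upwards [hf.eventually_differentiableAt, hR.eventually_differentiableAt, hfv]
      with q h1 h2 h3
    rw [pv_add_snd_smul h1 h2, h3]
    module
  have hWuu : pu (pu W) p = pu (pu f) p := by
    rw [(pu_congr hWu).eq_of_nhds,
      pu_add_snd_smul hf.partial_u.differentiableAt_top hR.partial_u.differentiableAt_top, hp]
    simp
  have hfuv : pv (pu f) p = 0 := pv_pu_eq_zero hp hf hh hfv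
  have hWuv : pv (pu W) p = pu R p := by
    rw [(pv_congr hWu).eq_of_nhds,
      pv_add_snd_smul hf.partial_u.differentiableAt_top hR.partial_u.differentiableAt_top, hp, hfuv]
    simp
  have hWvv : pv (pv W) p = h p + (2 : ℝ) • pv R p := by
    rw [(pv_congr hWv).eq_of_nhds,
      pv_add_snd_smul hR.differentiableAt_top (hh.add hR.partial_v).differentiableAt_top, hp]
    module
  have hWu0 : pu W p = pu f p := by simp [hWu.eq_of_nhds, hp]
  have hWv0 : pv W p = r p • ν p := by simp [hWv.eq_of_nhds, hp, hRdef]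
  have hRu : pu R p = r p • pu ν p + pu r p • ν p :=
    pu_smul hr.differentiableAt_top hν.differentiableAt_top
  have hRv : pv R p = r p • pv ν p + pv r p • ν p :=
    pv_smul hr.differentiableAt_top hν.differentiableAt_top
  have hνm : (⟪ν p, cross3 (pu f p) (ν p)⟫ : ℝ) = 0 := by
    simp only [inner_E3, cross3_zero, cross3_one, cross3_two]
    ring
  have hfu2 : ‖pu f p‖ ^ 2 ≠ 0 := by simpa using hfu
  have hm : ‖cross3 (pu f p) (ν p)‖ ≠ 0 := by
    intro h0
    have := norm_cross3_sq (pu f p) (ν p)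
    rw [h0, hν1, ho] at this
    apply hfu2
    linarith
  set c := ‖r p • cross3 (pu f p) (ν p)‖⁻¹ with hc
  have hc0 : c ≠ 0 := by simp [hc, norm_smul, hm, hr0]
  have hden : surfE W p * surfG W p - surfF W p ^ 2 ≠ 0 := by
    simp only [surfE, surfF, surfG, hWu0, hWv0, inner_smul_right, ho, norm_smul, hν1]
    simpa using ⟨hfu, hr0⟩
  rw [gaussK, div_eq_zero_iff, or_iff_left hden]
  simp only [surfL, surfM, surfN, surfn, hWuu, hWuv, hWvv, hWu0, hWv0, cross3_smul, ← hc, hRu, hRv,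
    inner_smul_right, inner_add_left, real_inner_smul_left, hνm]
  set m := cross3 (pu f p) (ν p)
  have key : ∀ s x y z : ℝ, c * (r p * s) * (c * (r p * (x + 2 * (r p * y)))) -
      (c * (r p * (r p * z))) ^ 2 = (c * r p) ^ 2 * (s * (x + 2 * r p * y) - (r p * z) ^ 2) := by
    intros
    ring
  simp only [mul_zero, add_zero]
  rw [key, mul_eq_zero_iff_left (pow_ne_zero 2 (mul_ne_zero hc0 hr0)), sub_eq_zero]


section Smooth

variable {f ν h : ℝ × ℝ → E3} {p : ℝ × ℝ}

/-- The radicand of `Btil`. -/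
def disc (f ν h : ℝ × ℝ → E3) (p : ℝ × ℝ) : ℝ :=
  (Atil f ν h p) ^ 2 -
    4 * p.2 * (Etil f p * Gtil h p - (Ftil f h p) ^ 2) *
      (Ltil f ν p * Ntil ν h p - p.2 * (Mtil ν h p) ^ 2)

theorem ContDiffAt.etil (hf : ContDiffAt ℝ (⊤ : ℕ∞) f p) : ContDiffAt ℝ (⊤ : ℕ∞) (Etil f) p :=
  hf.partial_u.norm_sq ℝ

theorem ContDiffAt.ftil (hf : ContDiffAt ℝ (⊤ : ℕ∞) f p) (hh : ContDiffAt ℝ (⊤ : ℕ∞) h p) :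
    ContDiffAt ℝ (⊤ : ℕ∞) (Ftil f h) p :=
  hf.partial_u.inner ℝ hh

theorem ContDiffAt.gtil (hh : ContDiffAt ℝ (⊤ : ℕ∞) h p) : ContDiffAt ℝ (⊤ : ℕ∞) (Gtil h) p :=
  hh.norm_sq ℝ

theorem ContDiffAt.ltil (hf : ContDiffAt ℝ (⊤ : ℕ∞) f p) (hν : ContDiffAt ℝ (⊤ : ℕ∞) ν p) :
    ContDiffAt ℝ (⊤ : ℕ∞) (Ltil f ν) p :=
  (hf.partial_u.inner ℝ hν.partial_u).neg

theorem ContDiffAt.mtil (hν : ContDiffAt ℝ (⊤ : ℕ∞) ν p) (hh : ContDiffAt ℝ (⊤ : ℕ∞) h p) :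
    ContDiffAt ℝ (⊤ : ℕ∞) (Mtil ν h) p :=
  (hh.inner ℝ hν.partial_u).neg

theorem ContDiffAt.ntil (hν : ContDiffAt ℝ (⊤ : ℕ∞) ν p) (hh : ContDiffAt ℝ (⊤ : ℕ∞) h p) :
    ContDiffAt ℝ (⊤ : ℕ∞) (Ntil ν h) p :=
  (hh.inner ℝ hν.partial_v).neg

theorem ContDiffAt.atil (hf : ContDiffAt ℝ (⊤ : ℕ∞) f p) (hν : ContDiffAt ℝ (⊤ : ℕ∞) ν p)
    (hh : ContDiffAt ℝ (⊤ : ℕ∞) h p) : ContDiffAt ℝ (⊤ : ℕ∞) (Atil f ν h) p :=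
  ((hf.etil.mul (hν.ntil hh)).sub
    (((contDiffAt_const.mul contDiffAt_snd).mul (hf.ftil hh)).mul (hν.mtil hh))).add
      ((contDiffAt_snd.mul hh.gtil).mul (hf.ltil hν))

theorem ContDiffAt.discr (hf : ContDiffAt ℝ (⊤ : ℕ∞) f p) (hν : ContDiffAt ℝ (⊤ : ℕ∞) ν p)
    (hh : ContDiffAt ℝ (⊤ : ℕ∞) h p) : ContDiffAt ℝ (⊤ : ℕ∞) (disc f ν h) p :=
  ((hf.atil hν hh).pow 2).sub
    (((contDiffAt_const.mul contDiffAt_snd).mul ((hf.etil.mul hh.gtil).sub ((hf.ftil hh).pow 2))).mul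
      (((hf.ltil hν).mul (hν.ntil hh)).sub (contDiffAt_snd.mul ((hν.mtil hh).pow 2))))

theorem ContDiffAt.btil (hf : ContDiffAt ℝ (⊤ : ℕ∞) f p) (hν : ContDiffAt ℝ (⊤ : ℕ∞) ν p)
    (hh : ContDiffAt ℝ (⊤ : ℕ∞) h p) (hp : p.2 = 0) (hA : 0 < Atil f ν h p) :
    ContDiffAt ℝ (⊤ : ℕ∞) (Btil f ν h) p :=
  (hf.discr hν hh).sqrt (by simpa [disc, hp] using hA.ne')

theorem ContDiffAt.kappa (hf : ContDiffAt ℝ (⊤ : ℕ∞) f p) (hν : ContDiffAt ℝ (⊤ : ℕ∞) ν p)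
    (hh : ContDiffAt ℝ (⊤ : ℕ∞) h p) (hp : p.2 = 0) (hA : 0 < Atil f ν h p) :
    ContDiffAt ℝ (⊤ : ℕ∞) (kap f ν h) p :=
  (contDiffAt_const.mul
    (((hf.ltil hν).mul (hν.ntil hh)).sub (contDiffAt_snd.mul ((hν.mtil hh).pow 2)))).div
    ((hf.atil hν hh).add (hf.btil hν hh hp hA))
    (add_pos_of_pos_of_nonneg hA (Real.sqrt_nonneg _)).ne'

theorem ContDiffAt.norm_cross3 (hf : ContDiffAt ℝ (⊤ : ℕ∞) f p) (hh : ContDiffAt ℝ (⊤ : ℕ∞) h p)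
    (hw : cross3 (pu f p) (h p) ≠ 0) :
    ContDiffAt ℝ (⊤ : ℕ∞) (fun q => ‖cross3 (pu f q) (h q)‖) p := by
  have h2 : ∀ q, ‖cross3 (pu f q) (h q)‖ ^ 2 =
      Etil f q * Gtil h q - Ftil f h q ^ 2 := fun q => norm_cross3_sq _ _
  have h1 : (fun q => ‖cross3 (pu f q) (h q)‖) =
      fun q => √(Etil f q * Gtil h q - Ftil f h q ^ 2) := by
    ext q
    rw [← h2, Real.sqrt_sq (norm_nonneg _)]
  rw [h1]
  refine ((hf.etil.mul hh.gtil).sub ((hf.ftil hh).pow 2)).sqrt ?_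
  rw [← h2]
  simpa using hw

theorem ContDiffAt.kappaHat (hf : ContDiffAt ℝ (⊤ : ℕ∞) f p) (hν : ContDiffAt ℝ (⊤ : ℕ∞) ν p)
    (hh : ContDiffAt ℝ (⊤ : ℕ∞) h p) (hp : p.2 = 0) (hA : 0 < Atil f ν h p)
    (hw : cross3 (pu f p) (h p) ≠ 0) : ContDiffAt ℝ (⊤ : ℕ∞) (kaphat f ν h) p :=
  ((hf.atil hν hh).add (hf.btil hν hh hp hA)).div
    (contDiffAt_const.mul (hf.norm_cross3 hh hw)) (by simpa using hw)

end Smooth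

theorem pv_kap_singular {f ν h : ℝ × ℝ → E3} {p : ℝ × ℝ}
    (hp : p.2 = 0) (hf : ContDiffAt ℝ (⊤ : ℕ∞) f p) (hν : ContDiffAt ℝ (⊤ : ℕ∞) ν p)
    (hh : ContDiffAt ℝ (⊤ : ℕ∞) h p)
    (hfv : pv f =ᶠ[𝓝 p] fun q => q.2 • h q) (hE : 0 < Etil f p) (hN : 0 < Ntil ν h p) :
    Etil f p ^ 3 * Ntil ν h p * pv (kap f ν h) p = 
      Etil f p ^ 2 * Ntil ν h p * pv (Ltil f ν) p -
        (Etil f p * Mtil ν h p - Ftil f h p * Ltil f ν p) ^ 2 := by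
  have hEs := hf.etil
  have hFs := hf.ftil hh
  have hGs := hh.gtil
  have hLs := hf.ltil hν
  have hMs := hν.mtil hh
  have hNs := hν.ntil hh
  have hAs := hf.atil hν hh
  have hA0 : Atil f ν h p = Etil f p * Ntil ν h p := by simp [Atil, hp]
  have hA : 0 < Atil f ν h p := hA0 ▸ mul_pos hE hN
  have hD : 0 < Atil f ν h p + Btil f ν h p := add_pos_of_pos_of_nonneg hA (Real.sqrt_nonneg _)
  have hts := hf.kappa hν hh hp hA
  have hdisc : 0 < disc f ν h p := by simpa [disc, hp] using pow_pos hA 2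
  have hquad : (fun q => Ltil f ν q * Ntil ν h q - Atil f ν h q * kap f ν h q +
      q.2 • ((Etil f q * Gtil h q - Ftil f h q ^ 2) * kap f ν h q ^ 2 - Mtil ν h q ^ 2))
      =ᶠ[𝓝 p] fun _ => 0 := by
    filter_upwards [(hAs.add (hf.btil hν hh hp hA)).continuousAt.eventually_ne hD.ne',
      (hf.discr hν hh).continuousAt.eventually (lt_mem_nhds hdisc)] with q hq hq'
    have hB : Btil f ν h q ^ 2 = disc f ν h q := Real.sq_sqrt hq'.le
    rw [disc] at hB
    simp only [kap, smul_eq_mul]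
    field_simp
    linear_combination (Ltil f ν q * Ntil ν h q - q.2 * Mtil ν h q ^ 2) * hB
  have hkap : Etil f p * kap f ν h p = Ltil f ν p := by
    have := hquad.eq_of_nhds
    simp only [hp, zero_smul, add_zero, hA0] at this
    apply mul_left_cancel₀ hN.ne'
    linear_combination -this
  have hEv : pv (Etil f) p = 0 := by
    have : Etil f = fun q => (⟪pu f q, pu f q⟫ : ℝ) := by
      ext q
      simp [Etil]
    rw [this, pv_inner hf.partial_u.differentiableAt_top hf.partial_u.differentiableAt_top,
      pv_pu_eq_zero hp hf hh hfv]
    simp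
  have hAv : pv (Atil f ν h) p = Etil f p * pv (Ntil ν h) p +
      (Gtil h p * Ltil f ν p - 2 * Ftil f h p * Mtil ν h p) := by
    have : Atil f ν h = fun q => Etil f q * Ntil ν h q +
        q.2 • (Gtil h q * Ltil f ν q - 2 * Ftil f h q * Mtil ν h q) := by
      ext q
      simp only [Atil, smul_eq_mul]
      ring
    rw [this, pv_add_snd_smul (hEs.mul hNs).differentiableAt_top
      ((hGs.mul hLs).sub ((contDiffAt_const.mul hFs).mul hMs)).differentiableAt_top,
      pv_mul hEs.differentiableAt_top hNs.differentiableAt_top, hEv, hp]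
    simp
  have hv := (pv_congr hquad).eq_of_nhds
  rw [pv_add_snd_smul ((hLs.mul hNs).sub (hAs.mul hts)).differentiableAt_top
      ((((hEs.mul hGs).sub (hFs.pow 2)).mul (hts.pow 2)).sub (hMs.pow 2)).differentiableAt_top,
    pv_sub (hLs.mul hNs).differentiableAt_top (hAs.mul hts).differentiableAt_top,
    pv_mul hLs.differentiableAt_top hNs.differentiableAt_top,
    pv_mul hAs.differentiableAt_top hts.differentiableAt_top, hAv, hA0, hp] at hv
  rw [pv_const, zero_smul, add_zero] at hv
  simp only [← hkap] at hv ⊢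
  linear_combination (-Etil f p ^ 2) * hv

/-- the Gaussian curvature of the focal surface `ŴFC_f` vanishes at
`p = (u₀,0)` iff `p` is a sub-parabolic point of `f`, i.e. `Ṽκ(p) = 0` for the extended
principal vector field `Ṽ = (v(λM̃−κ̂F̃), −λL̃+κ̂Ẽ)`. -/
theorem stmt14
    (U : Set (ℝ × ℝ)) (hU : IsOpen U)
    (f ν h : ℝ × ℝ → E3)
    (hf : ContDiffOn ℝ (⊤ : ℕ∞) f U) (hν : ContDiffOn ℝ (⊤ : ℕ∞) ν U) (hhsm : ContDiffOn ℝ (⊤ : ℕ∞) h U)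
    (hax : ∃ p ∈ U, p.2 = (0 : ℝ))
    (hν1 : ∀ p ∈ U, ‖ν p‖ = 1)
    (ho1 : ∀ p ∈ U, (⟪pu f p, ν p⟫ : ℝ) = 0)
    (ho2 : ∀ p ∈ U, (⟪pv f p, ν p⟫ : ℝ) = 0)
    (hfront : ∀ p ∈ U, Function.Injective ⇑(fderiv ℝ (fun q => (f q, ν q)) p))
    (hlam : ∀ p ∈ U, (lam f ν p = 0 ↔ p.2 = 0))
    (hh0 : ∀ p ∈ U, h p ≠ 0)
    (hfv : ∀ p ∈ U, pv f p = p.2 • h p)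
    (hνdef : ∀ p ∈ U, ν p = ‖cross3 (pu f p) (h p)‖⁻¹ • cross3 (pu f p) (h p))
    (hNpos : ∀ p ∈ U, p.2 = 0 → 0 < Ntil ν h p)
    (u₀ : ℝ) (hp : ((u₀, 0) : ℝ × ℝ) ∈ U) :
    gaussK (FChat f ν h) (u₀, 0) = 0 ↔
      ((u₀, (0:ℝ)).2 * (lam f ν (u₀, 0) * Mtil ν h (u₀, 0) - kaphat f ν h (u₀, 0) * Ftil f h (u₀, 0)))
          * pu (kap f ν h) (u₀, 0)
        + (-(lam f ν (u₀, 0) * Ltil f ν (u₀, 0)) + kaphat f ν h (u₀, 0) * Etil f (u₀, 0))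
          * pv (kap f ν h) (u₀, 0) = 0 := by
  set p : ℝ × ℝ := (u₀, 0)
  have hU' : U ∈ 𝓝 p := hU.mem_nhds hp
  have hp2 : p.2 = 0 := rfl
  have hfs : ContDiffAt ℝ (⊤ : ℕ∞) f p := hf.contDiffAt hU'
  have hνs : ContDiffAt ℝ (⊤ : ℕ∞) ν p := hν.contDiffAt hU'
  have hhs : ContDiffAt ℝ (⊤ : ℕ∞) h p := hhsm.contDiffAt hU'
  have hfv' : pv f =ᶠ[𝓝 p] fun q => q.2 • h q := by
    filter_upwards [hU'] with q hq using hfv q hq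
  have hw : ∀ q ∈ U, cross3 (pu f q) (h q) ≠ 0 := by
    intro q hq h0
    have := hν1 q hq
    rw [hνdef q hq, h0] at this
    simp at this
  have hcross : ∀ q ∈ U, cross3 (pu f q) (h q) = ‖cross3 (pu f q) (h q)‖ • ν q := by
    intro q hq
    rw [hνdef q hq, smul_inv_smul₀ (norm_ne_zero_iff.2 (hw q hq))]
  have hfu : pu f p ≠ 0 := by
    intro h0
    apply hw p hp
    ext i
    fin_cases i <;> simp [h0]
  have hE : 0 < Etil f p := pow_pos (norm_pos_iff.2 hfu) 2
  have hN : 0 < Ntil ν h p := hNpos p hp rfl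
  have hA0 : Atil f ν h p = Etil f p * Ntil ν h p := by simp [Atil, hp2]
  have hA : 0 < Atil f ν h p := hA0 ▸ mul_pos hE hN
  have hB : Btil f ν h p = Etil f p * Ntil ν h p := by
    simp [Btil, hp2, hA0, Real.sqrt_sq (mul_pos hE hN).le]
  set w := ‖cross3 (pu f p) (h p)‖ with hwdef
  have hw0 : 0 < w := norm_pos_iff.2 (hw p hp)
  have hkh : kaphat f ν h p = Etil f p * Ntil ν h p / w := by
    rw [kaphat, hA0, hB, ← hwdef]
    field_simp
    ring
  have hkh0 : 0 < kaphat f ν h p := hkh ▸ div_pos (mul_pos hE hN) hw0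
  set r : ℝ × ℝ → ℝ := fun q => ‖cross3 (pu f q) (h q)‖ / kaphat f ν h q with hr
  have hrs : ContDiffAt ℝ (⊤ : ℕ∞) r p :=
    (hfs.norm_cross3 hhs (hw p hp)).div (hfs.kappaHat hνs hhs rfl hA (hw p hp)) hkh0.ne'
  have hrp : r p = w ^ 2 / (Etil f p * Ntil ν h p) := by
    simp only [hr, hkh, ← hwdef]
    field_simp
  have hFC : FChat f ν h =ᶠ[𝓝 p] fun q => f q + q.2 • r q • ν q := by
    filter_upwards [hU'] with q hq
    have : lam f ν q = q.2 * ‖cross3 (pu f q) (h q)‖ := by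
      rw [lam, det3, inner_cross3_cyclic, hfv q hq, cross3_smul, inner_smul_right, hcross q hq,
        inner_smul_right, real_inner_self_eq_norm_sq, norm_smul, hν1 q hq]
      simp
    rw [FChat, this, hr, smul_smul, mul_div_assoc]
  rw [gaussK_congr hFC, gaussK_offset_eq_zero_iff hp2 hfs hνs hhs hrs hfv' (hν1 p hp) (ho1 p hp) hfu
    (by rw [hrp]; positivity)]
  have hlam0 : lam f ν p = 0 := (hlam p hp).2 rfl
  rw [hlam0]
  have hE3N : 0 < Etil f p ^ 3 * Ntil ν h p := by positivity
  have hrhs : ((0 : ℝ) * (0 * Mtil ν h p - kaphat f ν h p * Ftil f h p)) * pu (kap f ν h) p +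
      (-(0 * Ltil f ν p) + kaphat f ν h p * Etil f p) * pv (kap f ν h) p =
      (kaphat f ν h p * Etil f p) * pv (kap f ν h) p := by ring
  rw [hrhs, mul_eq_zero_iff_left (by positivity), ← mul_eq_zero_iff_left hE3N.ne',
    pv_kap_singular hp2 hfs hνs hhs hfv' hE hN, sub_eq_zero]
  have hfνv : (fun q => (⟪pu f q, pv ν q⟫ : ℝ)) =ᶠ[𝓝 p] fun q => q.2 • -(⟪pu h q, ν q⟫ : ℝ) := by
    have ho : (fun q => (⟪pu f q, ν q⟫ : ℝ)) =ᶠ[𝓝 p] fun _ => 0 := by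
      filter_upwards [hU'] with q hq using ho1 q hq
    filter_upwards [pv_congr ho, hU', hfv'.eventuallyEq_nhds] with q hq hqU hqv
    have hfq := hf.contDiffAt (hU.mem_nhds hqU)
    rw [pv_inner hfq.partial_u.differentiableAt_top
      (hν.contDiffAt (hU.mem_nhds hqU)).differentiableAt_top, pv_pu_comm hfq,
      (pu_congr hqv).eq_of_nhds,
      pu_snd_smul (hhsm.contDiffAt (hU.mem_nhds hqU)).differentiableAt_top] at hq
    rw [pv_const, real_inner_smul_left] at hq
    rw [smul_eq_mul]
    linarith
  have ha : (⟪pu f p, pv ν p⟫ : ℝ) = 0 := by simpa [hp2] using hfνv.eq_of_nhds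
  have hn : (⟪ν p, pv ν p⟫ : ℝ) = 0 := by
    have ho : (fun q => (⟪ν q, ν q⟫ : ℝ)) =ᶠ[𝓝 p] fun _ => 1 := by
      filter_upwards [hU'] with q hq
      simp [hν1 q hq]
    have := (pv_congr ho).eq_of_nhds
    rw [pv_inner hνs.differentiableAt_top hνs.differentiableAt_top, pv_const,
      real_inner_comm (ν p) (pv ν p)] at this
    linarith
  have hLv : pv (Ltil f ν) p = ⟪pu (pu f) p, pv ν p⟫ := by
    have h1 : pv (Ltil f ν) p = -pv (fun q => (⟪pu f q, pu ν q⟫ : ℝ)) p := by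
      change fderiv ℝ (fun q => -(⟪pu f q, pu ν q⟫ : ℝ)) p (0, 1) = _
      simp [pv, fderiv_fun_neg]
    have h2 := (pu_congr hfνv).eq_of_nhds
    rw [pu_inner hfs.partial_u.differentiableAt_top hνs.partial_v.differentiableAt_top,
      pu_snd_smul (hhs.partial_u.inner ℝ hνs).neg.differentiableAt_top, hp2, zero_smul] at h2
    rw [h1, pv_inner hfs.partial_u.differentiableAt_top hνs.partial_u.differentiableAt_top,
      pv_pu_eq_zero hp2 hfs hhs hfv', inner_zero_left, pv_pu_comm hνs]
    linarith
  have hm2 : ‖cross3 (pu f p) (ν p)‖ ^ 2 = Etil f p := by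
    rw [norm_cross3_sq, hν1 p hp, ho1 p hp, Etil]
    ring
  have hwm : ∀ x, w * (⟪x, cross3 (pu f p) (ν p)⟫ : ℝ) =
      Ftil f h p * ⟪pu f p, x⟫ - Etil f p * ⟪h p, x⟫ := by
    intro x
    rw [Ftil, Etil, ← inner_cross3_cross3, hcross p hp, cross3_smul, inner_smul_right]
  have hmh : (⟪h p, cross3 (pu f p) (ν p)⟫ : ℝ) = -w := by
    rw [inner_cross3_swap, hcross p hp, inner_smul_right, real_inner_self_eq_norm_sq, hν1 p hp]
    ring
  have hmνv : (⟪pv ν p, cross3 (pu f p) (ν p)⟫ : ℝ) = Etil f p * Ntil ν h p / w := by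
    rw [eq_div_iff hw0.ne', mul_comm, hwm, ha, Ntil]
    ring
  have hmνu : (⟪pu ν p, cross3 (pu f p) (ν p)⟫ : ℝ) =
      (Etil f p * Mtil ν h p - Ftil f h p * Ltil f ν p) / w := by
    rw [eq_div_iff hw0.ne', mul_comm, hwm, Mtil, Ltil]
    ring
  have hs := inner_mul_norm_cross3_sq ha hn (pu (pu f) p)
  rw [hm2, hmνv] at hs
  have hs' : (⟪pu (pu f) p, pv ν p⟫ : ℝ) =
      Ntil ν h p / w * ⟪pu (pu f) p, cross3 (pu f p) (ν p)⟫ := by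
    apply mul_right_cancel₀ hE.ne'
    rw [hs]
    ring
  rw [hLv, hs', hmh, hmνv, hmνu, hrp]
  generalize (⟪pu (pu f) p, cross3 (pu f p) (ν p)⟫ : ℝ) = s
  generalize Etil f p * Mtil ν h p - Ftil f h p * Ltil f ν p = T
  field_simp
  ring_nf
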